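/- Let A be a complex unital Banach algebra. Fix k ≥ 1, integers x_1 > x_2 > ⋯ > x_k ≥ 1, elements a_z ∈ A for 1 ≤ z ≤ x_1 − 1, and elements b_1, …, b_k ∈ A. For x > 1 set u_x = exp(a_{x-1}) exp(a_{x-2}) ⋯ exp(a_1), and u_1 = 1; each u_x is invertible. Then (u_{x_1}⁻¹ b_1 u_{x_1}) · (u_{x_2}⁻¹ b_2 u_{x_2}) ⋯ (u_{x_k}⁻¹ b_k u_{x_k}) = ∑_{n=0}^∞ ∑_{n_1+⋯+n_k=n} ∑_{z} Υ(z_1,…,z_n) · K(z), where: the composition sum is over all (n_1,…,n_k) of nonnegative integers summing to n; the inner sum is over z_1,…,z_{n_1} ∈ {x_2,…,x_1−1}, z_{n_1+1},…,z_{n_1+n_2} ∈ {x_3,…,x_2−1}, …, z_{n_1+⋯+n_{k-1}+1},…,z_n ∈ {1,…,x_k−1}; and K(z) is built by starting from b_1, taking iterated commutators with a_{z_1},…,a_{z_{n_1}}, multiplying the result on the right by b_2, taking iterated commutators with the second segment's a's, and so on through right-multiplication by b_k followed by iterated commutators with the last segment's a's. Each inner sum is finite and the outer series over n converges absolutely in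 A. -/

import Mathlib

open scoped BigOperators

/-- The `Υ` function on a finite sequence of naturals: `0` unless the sequence is
nonincreasing, and `1 / ∏_v m_v!` otherwise, where `m_v` is the number of entries
equal to `v`. -/
noncomputable def Upsilon {n : ℕ} (z : Fin n → ℕ) : ℚ :=
  if ∀ i j : Fin n, i ≤ j → z j ≤ z i then
    ((∏ v ∈ Finset.univ.image z,
        (Finset.univ.filter fun i => z i = v).card.factorial : ℕ) : ℚ)⁻¹
  else 0

/-- The iterated (nested) commutator of `a` with the entries of the list `l`. -/
def nestComm {A : Type*} [Ring A] (a : A) (l : List A) : A :=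
  l.foldl (fun x h => x * h - h * x) a

/-- `Ufwd a x y = exp(a_{x-1}) exp(a_{x-2}) ⋯ exp(a_y)`.  In particular
`Ufwd a x 1 = exp(a_{x-1}) ⋯ exp(a_1)` is the evolution operator `u_x`
(and `Ufwd a 1 1 = 1`). -/
noncomputable def Ufwd {A : Type*} [NormedRing A] [NormedAlgebra ℂ A]
    (a : ℕ → A) (x y : ℕ) : A :=
  (List.ofFn fun i : Fin (x - y) => NormedSpace.exp (a (x - 1 - (i : ℕ)))).prod

/-- `Ubwd a x y = exp(-a_y) exp(-a_{y+1}) ⋯ exp(-a_{x-1})`, the inverse of `Ufwd a x y`. -/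
noncomputable def Ubwd {A : Type*} [NormedRing A] [NormedAlgebra ℂ A]
    (a : ℕ → A) (x y : ℕ) : A :=
  (List.ofFn fun i : Fin (x - y) => NormedSpace.exp (-a (y + (i : ℕ)))).prod

/-- Partial sums of a composition `nv : Fin k → ℕ`: `psum nv j = nv 0 + ⋯ + nv (j-1)`. -/
def psum {k : ℕ} (nv : Fin k → ℕ) (j : ℕ) : ℕ :=
  ∑ t ∈ Finset.range j, if h : t < k then nv ⟨t, h⟩ else 0

/-- The (0-indexed) segment of the composition `nv` containing position `i`:
the number of `j < k` with `psum nv (j+1) ≤ i`. -/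
def segIdx {k : ℕ} (nv : Fin k → ℕ) (i : ℕ) : ℕ :=
  ((Finset.range k).filter fun j => psum nv (j + 1) ≤ i).card

/-- The nested structure `K`: starting from `b 1`, take iterated commutators with
the `w`'s of the first segment, multiply on the right by `b 2`, take iterated
commutators with the `w`'s of the second segment, and so on.  `Kfam b w ps j` is the
result after `j` segments, the segments being delimited by the partial sums `ps`. -/
def Kfam {A : Type*} [Ring A] (b : ℕ → A) (w : ℕ → A) (ps : ℕ → ℕ) : ℕ → A
  | 0 => b 1
  | j + 1 =>
      nestComm (Kfam b w ps j * if j = 0 then 1 else b (j + 1))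
        ((List.range (ps (j + 1) - ps j)).map fun t => w (ps j + t))

section MultiplicityForm

variable {A : Type*} [Ring A]

/-- Starting from `c`, take iterated commutators with `a (y-1)`, …, `a (y-d)`, each `a v` being
used `m v` times. -/
def segComm (a : ℕ → A) (m : ℕ → ℕ) (y : ℕ) (c : A) : ℕ → A
  | 0 => c
  | d + 1 => nestComm (segComm a m y c d) (List.replicate (m (y - (d + 1))) (a (y - (d + 1))))

/-- `Kfam` expressed through the multiplicities of the indices, for the segments
`[X (j + 1), X j)`. -/
def multComm (a b : ℕ → A) (X : ℕ → ℕ) (m : ℕ → ℕ) : ℕ → A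
  | 0 => b 1
  | j + 1 => segComm a m (X (j + 1)) (multComm a b X m j * if j = 0 then 1 else b (j + 1))
      (X (j + 1) - X (j + 2))

end MultiplicityForm

section PowerSeries

variable {A : Type*} [NormedRing A] [NormedAlgebra ℂ A]

/-- The bounded operator `c ↦ c * h - h * c`. -/
noncomputable def commOp (h : A) : A →L[ℂ] A :=
  (ContinuousLinearMap.mul ℂ A).flip h - ContinuousLinearMap.mul ℂ A h

lemma commOp_pow_apply (h c : A) (q : ℕ) :
    (commOp h ^ q) c = nestComm c (List.replicate q h) := by
  induction q generalizing c with
  | zero => simp [nestComm]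
  | succ q ih =>
    rw [pow_succ, mul_apply_eq_comp, ih]
    simp [nestComm, commOp, List.replicate_succ]

lemma mul_pow_apply (h c : A) (q : ℕ) : (ContinuousLinearMap.mul ℂ A h ^ q) c = h ^ q * c := by
  induction q generalizing c with
  | zero => simp
  | succ q ih =>
    rw [pow_succ, mul_apply_eq_comp, ih]
    simp [pow_succ, mul_assoc]

lemma mul_flip_pow_apply (h c : A) (q : ℕ) :
    ((ContinuousLinearMap.mul ℂ A).flip h ^ q) c = c * h ^ q := by
  induction q generalizing c with
  | zero => simp
  | succ q ih =>
    rw [pow_succ, mul_apply_eq_comp, ih]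
    simp [pow_succ', mul_assoc]

variable [CompleteSpace A]

lemma exp_mul_apply (h c : A) :
    NormedSpace.exp (ContinuousLinearMap.mul ℂ A h) c = NormedSpace.exp h * c := by
  have h1 := (NormedSpace.exp_series_hasSum_exp' (𝕂 := ℂ)
    (ContinuousLinearMap.mul ℂ A h)).mapL (ContinuousLinearMap.apply ℂ A c)
  have h2 := (NormedSpace.exp_series_hasSum_exp' (𝕂 := ℂ) h).mul_right c
  simp only [ContinuousLinearMap.apply_apply, smul_apply, mul_pow_apply] at h1
  exact h1.unique (by simpa using h2)

lemma exp_mul_flip_apply (h c : A) :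
    NormedSpace.exp ((ContinuousLinearMap.mul ℂ A).flip h) c = c * NormedSpace.exp h := by
  have h1 := (NormedSpace.exp_series_hasSum_exp' (𝕂 := ℂ)
    ((ContinuousLinearMap.mul ℂ A).flip h)).mapL (ContinuousLinearMap.apply ℂ A c)
  have h2 := (NormedSpace.exp_series_hasSum_exp' (𝕂 := ℂ) h).mul_left c
  simp only [ContinuousLinearMap.apply_apply, smul_apply,
    mul_flip_pow_apply] at h1
  exact h1.unique (by simpa using h2)

lemma exp_commOp_apply (h c : A) :
    NormedSpace.exp (commOp h) c = NormedSpace.exp (-h) * c * NormedSpace.exp h := by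
  let _ := NormedAlgebra.restrictScalars ℚ ℂ (A →L[ℂ] A)
  have hc : Commute ((ContinuousLinearMap.mul ℂ A).flip h) (ContinuousLinearMap.mul ℂ A (-h)) := by
    ext c
    simp [mul_assoc]
  have : commOp h = (ContinuousLinearMap.mul ℂ A).flip h + ContinuousLinearMap.mul ℂ A (-h) := by
    ext c
    simp [commOp, sub_eq_add_neg]
  rw [this, NormedSpace.exp_add_of_commute hc, mul_apply_eq_comp, exp_mul_apply,
    exp_mul_flip_apply]

/-- Conjugating an absolutely convergent series by an exponential is a Cauchy product with the
series of iterated commutators. -/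
lemma hasSum_exp_conj {c : ℕ → A} {s : A} (hc : Summable fun n => ‖c n‖) (hs : HasSum c s)
    (h : A) :
    (Summable fun n => ‖∑ p ∈ Finset.HasAntidiagonal.antidiagonal n,
      ((p.1.factorial : ℂ)⁻¹) • nestComm (c p.2) (List.replicate p.1 h)‖) ∧
    HasSum (fun n => ∑ p ∈ Finset.HasAntidiagonal.antidiagonal n,
      ((p.1.factorial : ℂ)⁻¹) • nestComm (c p.2) (List.replicate p.1 h))
      (NormedSpace.exp (-h) * s * NormedSpace.exp h) := by
  set E : ℕ → A →L[ℂ] A := fun q => ((q.factorial : ℂ)⁻¹) • commOp h ^ q with hE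
  set L : ℕ → A →L[ℂ] A := fun p => ContinuousLinearMap.mul ℂ A (c p) with hL
  have hEn : Summable fun q => ‖E q‖ := NormedSpace.norm_expSeries_summable' (𝕂 := ℂ) (commOp h)
  have hEs : HasSum E (NormedSpace.exp (commOp h)) := NormedSpace.exp_series_hasSum_exp' _
  have hLn : Summable fun p => ‖L p‖ :=
    Summable.of_nonneg_of_le (fun _ => norm_nonneg _)
      (fun p => ContinuousLinearMap.opNorm_mul_apply_le ℂ A (c p)) hc
  have hLs : HasSum L (ContinuousLinearMap.mul ℂ A s) := hs.mapL (ContinuousLinearMap.mul ℂ A)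
  have hcauchy := summable_norm_sum_mul_antidiagonal_of_summable_norm hEn hLn
  have htsum := tsum_mul_tsum_eq_tsum_sum_antidiagonal_of_summable_norm hEn hLn
  rw [hEs.tsum_eq, hLs.tsum_eq] at htsum
  have hsum := hcauchy.of_norm.hasSum
  rw [← htsum] at hsum
  have hval : ∀ n, (∑ p ∈ Finset.HasAntidiagonal.antidiagonal n, E p.1 * L p.2) 1 =
      ∑ p ∈ Finset.HasAntidiagonal.antidiagonal n,
        ((p.1.factorial : ℂ)⁻¹) • nestComm (c p.2) (List.replicate p.1 h) := by
    intro n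
    simp only [hE, hL, sum_apply, mul_apply_eq_comp,
      smul_apply, ContinuousLinearMap.mul_apply', mul_one, commOp_pow_apply]
  constructor
  · refine Summable.of_nonneg_of_le (fun _ => norm_nonneg _) (fun n => ?_)
      (hcauchy.mul_right ‖(1 : A)‖)
    rw [← hval]
    exact ContinuousLinearMap.le_opNorm _ _
  · have := hsum.mapL (ContinuousLinearMap.apply ℂ A (1 : A))
    simp only [ContinuousLinearMap.apply_apply, hval] at this
    simpa [exp_commOp_apply] using this


/-- The coefficient of total degree `n` in the exponential-type series over multiplicity
functions supported on `[y, N)` with terms `Φ m / ∏ m_v!`. -/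
noncomputable def expCoeff (y N : ℕ) (Φ : (ℕ → ℕ) → A) (n : ℕ) : A :=
  ∑ m ∈ Finset.piAntidiag (Finset.Ico y N) n,
    (∏ v ∈ Finset.Ico y N, ((m v).factorial : ℂ)⁻¹) • Φ m

/-- `Φ` depends only on the multiplicities of the values `≥ y`, and the series of its
coefficients over multiplicity functions supported on `[y, N)` converges absolutely to `s`. -/
structure IsExpansion (y N : ℕ) (Φ : (ℕ → ℕ) → A) (s : A) : Prop where
  congr : ∀ m m' : ℕ → ℕ, (∀ v, y ≤ v → m v = m' v) → Φ m = Φ m'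
  summable_norm : Summable fun n => ‖expCoeff y N Φ n‖
  hasSum : HasSum (expCoeff y N Φ) s

omit [CompleteSpace A] in
lemma isExpansion_const (N : ℕ) (c : A) : IsExpansion N N (fun _ => c) c := by
  have h : expCoeff N N (fun _ => c) = fun n => if n = 0 then c else 0 := by
    ext n
    by_cases hn : n = 0 <;> simp [expCoeff, hn]
  refine ⟨fun _ _ _ => rfl, ?_, ?_⟩
  · rw [h]
    exact summable_of_ne_finset_zero (s := {0}) fun n hn => by simp_all
  · rw [h]
    exact hasSum_ite_eq 0 c

omit [CompleteSpace A] in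
lemma IsExpansion.mul_right {y N : ℕ} {Φ : (ℕ → ℕ) → A} {s : A} (h : IsExpansion y N Φ s)
    (b : A) : IsExpansion y N (fun m => Φ m * b) (s * b) := by
  have he : expCoeff y N (fun m => Φ m * b) = fun n => expCoeff y N Φ n * b := by
    ext n
    simp [expCoeff, Finset.sum_mul]
  refine ⟨fun m m' hm => by simp only [h.congr m m' hm], ?_, ?_⟩
  · rw [he]
    exact Summable.of_nonneg_of_le (fun _ => norm_nonneg _) (fun n => norm_mul_le _ _)
      (h.summable_norm.mul_right ‖b‖)
  · rw [he]
    exact h.hasSum.mul_right b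

lemma IsExpansion.nestComm_replicate {w N : ℕ} (hw : w < N) {Φ : (ℕ → ℕ) → A} {s : A}
    (h : IsExpansion (w + 1) N Φ s) (x : A) :
    IsExpansion w N (fun m => nestComm (Φ m) (List.replicate (m w) x))
      (NormedSpace.exp (-x) * s * NormedSpace.exp x) := by
  have hw' : w ∉ Finset.Ico (w + 1) N := by simp
  have hI : Finset.Ico w N = Finset.cons w (Finset.Ico (w + 1) N) hw' := by
    ext v
    simp only [Finset.mem_Ico, Finset.mem_cons]
    omega
  have he : expCoeff w N (fun m => nestComm (Φ m) (List.replicate (m w) x)) =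
      fun n => ∑ p ∈ Finset.HasAntidiagonal.antidiagonal n, ((p.1.factorial : ℂ)⁻¹) •
        nestComm (expCoeff (w + 1) N Φ p.2) (List.replicate p.1 x) := by
    ext n
    unfold expCoeff
    rw [hI, Finset.piAntidiag_cons, Finset.sum_disjiUnion]
    refine Finset.sum_congr rfl fun p _ => ?_
    rw [Finset.sum_map, ← commOp_pow_apply, map_sum, Finset.smul_sum]
    refine Finset.sum_congr rfl fun m hm => ?_
    have hmw : m w = 0 := by
      by_contra h0
      exact hw' ((Finset.mem_piAntidiag.1 hm).2 w h0)
    rw [map_smul, smul_smul, commOp_pow_apply, Finset.prod_cons]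
    have hΦ : Φ (m + fun t => if t = w then p.1 else 0) = Φ m :=
      h.congr _ _ fun v hv => by simp [show v ≠ w by omega]
    have hprod : ∏ v ∈ Finset.Ico (w + 1) N,
        (((m + fun t => if t = w then p.1 else 0) v).factorial : ℂ)⁻¹ =
        ∏ v ∈ Finset.Ico (w + 1) N, ((m v).factorial : ℂ)⁻¹ := by
      refine Finset.prod_congr rfl fun v hv => ?_
      have := (Finset.mem_Ico.1 hv).1
      simp [show v ≠ w by omega]
    simp only [addRightEmbedding_apply, hΦ, hprod]
    simp [hmw]
  have key := hasSum_exp_conj h.summable_norm h.hasSum x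
  refine ⟨fun m m' hm => ?_, ?_, ?_⟩
  · simp only [h.congr m m' fun v hv => hm v (by omega), hm w le_rfl]
  · rw [he]
    exact key.1
  · rw [he]
    exact key.2

omit [CompleteSpace A] in
lemma Ufwd_succ (a : ℕ → A) {w : ℕ} (hw : 1 ≤ w) :
    Ufwd a (w + 1) 1 = NormedSpace.exp (a w) * Ufwd a w 1 := by
  obtain ⟨w, rfl⟩ := Nat.exists_eq_add_of_le' hw
  simp [Ufwd, List.ofFn_succ, Nat.add_sub_add_right, add_comm]

omit [CompleteSpace A] in
lemma Ubwd_succ (a : ℕ → A) {w : ℕ} (hw : 1 ≤ w) :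
    Ubwd a (w + 1) 1 = Ubwd a w 1 * NormedSpace.exp (-a w) := by
  obtain ⟨w, rfl⟩ := Nat.exists_eq_add_of_le' hw
  simp only [Ubwd, Nat.add_sub_cancel]
  rw [List.ofFn_succ']
  simp [add_comm]

lemma Ufwd_mul_Ubwd (a : ℕ → A) {w : ℕ} (hw : 1 ≤ w) : Ufwd a w 1 * Ubwd a w 1 = 1 := by
  let _ := NormedAlgebra.restrictScalars ℚ ℂ A
  induction w, hw using Nat.le_induction with
  | base => simp [Ufwd, Ubwd]
  | succ w hw ih =>
    rw [Ufwd_succ a hw, Ubwd_succ a hw, mul_assoc, ← mul_assoc (Ufwd a w 1), ih, one_mul,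
      ← NormedSpace.exp_add_of_commute (Commute.neg_right (Commute.refl _))]
    simp

lemma IsExpansion.segComm {y N : ℕ} (hy : y ≤ N) {Φ : (ℕ → ℕ) → A} {s : A}
    (h : IsExpansion y N Φ s) (a : ℕ → A) (d : ℕ) (hd : d < y) :
    ∃ s', IsExpansion (y - d) N (fun m => segComm a m y (Φ m) d) s' ∧
      Ubwd a (y - d) 1 * s' * Ufwd a (y - d) 1 = Ubwd a y 1 * s * Ufwd a y 1 := by
  induction d with
  | zero => exact ⟨s, h, rfl⟩
  | succ d ih =>
    obtain ⟨s', hs', hU⟩ := ih (by omega)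
    have hyd : y - d = (y - (d + 1)) + 1 := by omega
    rw [hyd] at hs' hU
    refine ⟨_, hs'.nestComm_replicate (by omega) (a (y - (d + 1))), ?_⟩
    rw [← hU, Ufwd_succ a (by omega), Ubwd_succ a (by omega)]
    simp only [mul_assoc]

lemma exists_isExpansion_multComm (a b : ℕ → A) {X : ℕ → ℕ} (hX : ∀ q, 1 ≤ q → X (q + 1) ≤ X q)
    (hX1 : ∀ q, 1 ≤ X q) (j : ℕ) :
    ∃ s, IsExpansion (X (j + 1)) (X 1)
        (fun m => multComm a b X m j * if j = 0 then 1 else b (j + 1)) s ∧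
      Ubwd a (X (j + 1)) 1 * s * Ufwd a (X (j + 1)) 1 =
        (List.ofFn fun i : Fin (j + 1) =>
          Ubwd a (X ((i : ℕ) + 1)) 1 * b ((i : ℕ) + 1) * Ufwd a (X ((i : ℕ) + 1)) 1).prod := by
  have hXle : ∀ q, X (q + 1) ≤ X 1 := fun q => by
    induction q with
    | zero => exact le_rfl
    | succ q ih => exact (hX _ (by omega)).trans ih
  induction j with
  | zero => exact ⟨b 1, by simpa [multComm] using isExpansion_const (X 1) (b 1), by simp⟩
  | succ j ih =>
    obtain ⟨s, hs, hU⟩ := ih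
    have h1 := hX (j + 1) (by omega)
    have h2 := hX1 (j + 1 + 1)
    obtain ⟨s', hs', hU'⟩ := hs.segComm (hXle j) a (X (j + 1) - X (j + 1 + 1)) (by omega)
    rw [Nat.sub_sub_self h1] at hs' hU'
    refine ⟨s' * b (j + 1 + 1), by simpa [multComm] using hs'.mul_right (b (j + 1 + 1)), ?_⟩
    rw [List.ofFn_succ']
    simp only [List.concat_eq_append, List.prod_append, Fin.val_castSucc, ← hU, ← hU',
      List.prod_singleton, Fin.val_last]
    simp only [mul_assoc]
    rw [← mul_assoc (Ufwd a _ 1) (Ubwd a _ 1), Ufwd_mul_Ubwd a h2, one_mul]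

/-- The product of conjugated elements is the sum of the series of `multComm`. -/
lemma isExpansion_multComm (a b : ℕ → A) {X : ℕ → ℕ} (hX : ∀ q, 1 ≤ q → X (q + 1) ≤ X q)
    (hX1 : ∀ q, 1 ≤ X q) {k : ℕ} (hk : 1 ≤ k) (hXk : X (k + 1) = 1) :
    IsExpansion 1 (X 1) (fun m => multComm a b X m k)
      (List.ofFn fun i : Fin k =>
        Ubwd a (X ((i : ℕ) + 1)) 1 * b ((i : ℕ) + 1) * Ufwd a (X ((i : ℕ) + 1)) 1).prod := by
  have hXle : ∀ q, X (q + 1) ≤ X 1 := fun q => by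
    induction q with
    | zero => exact le_rfl
    | succ q ih => exact (hX _ (by omega)).trans ih
  obtain ⟨j, rfl⟩ := Nat.exists_eq_add_of_le' hk
  obtain ⟨s, hs, hU⟩ := exists_isExpansion_multComm a b hX hX1 j
  have h1 := hX (j + 1) (by omega)
  have h2 := hX1 (j + 1 + 1)
  obtain ⟨s', hs', hU'⟩ := hs.segComm (hXle j) a (X (j + 1) - X (j + 1 + 1)) (by omega)
  rw [Nat.sub_sub_self h1, hXk] at hs' hU'
  have : s' = (List.ofFn fun i : Fin (j + 1) =>
      Ubwd a (X ((i : ℕ) + 1)) 1 * b ((i : ℕ) + 1) * Ufwd a (X ((i : ℕ) + 1)) 1).prod := by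
    rw [← hU, ← hU']
    simp [Ufwd, Ubwd]
  rw [← this]
  simpa only [multComm, hXk] using hs'

end PowerSeries

section Multiplicities

lemma lt_card_filter_range_iff {p : ℕ → Prop} [DecidablePred p]
    (hp : ∀ i j, i ≤ j → p j → p i) {j k : ℕ} (hj : j < k) :
    j < ((Finset.range k).filter p).card ↔ p j := by
  constructor
  · intro h
    by_contra hpj
    have hsub : (Finset.range k).filter p ⊆ Finset.range j := fun i hi => by
      rw [Finset.mem_filter] at hi
      rw [Finset.mem_range]
      by_contra hij
      exact hpj (hp j i (by omega) hi.2)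
    have := Finset.card_le_card hsub
    rw [Finset.card_range] at this
    omega
  · intro hpj
    have hsub : Finset.range (j + 1) ⊆ (Finset.range k).filter p := fun i hi => by
      rw [Finset.mem_range] at hi
      rw [Finset.mem_filter, Finset.mem_range]
      exact ⟨by omega, hp i j (by omega) hpj⟩
    have := Finset.card_le_card hsub
    rw [Finset.card_range] at this
    omega

lemma card_filter_fin_eq_card_filter_range (n : ℕ) (p : ℕ → Prop) [DecidablePred p] :
    (Finset.univ.filter fun i : Fin n => p i).card = ((Finset.range n).filter p).card := by
  rw [Finset.card_filter, Finset.card_filter,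
    Fin.sum_univ_eq_sum_range (fun i => if p i then 1 else 0)]

lemma card_filter_fin_lt {n c : ℕ} (hc : c ≤ n) :
    (Finset.univ.filter fun i : Fin n => (i : ℕ) < c).card = c := by
  rw [card_filter_fin_eq_card_filter_range n (fun i => i < c)]
  have : (Finset.range n).filter (fun i => i < c) = Finset.range c := by
    ext i
    simp only [Finset.mem_filter, Finset.mem_range]
    omega
  rw [this, Finset.card_range]

/-- The number of entries `≥ w`, in terms of the multiplicities `m` of the values below `N`. -/
def tailSum (m : ℕ → ℕ) (N w : ℕ) : ℕ := ∑ v ∈ Finset.Ico w N, m v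

lemma tailSum_anti (m : ℕ → ℕ) (N : ℕ) : Antitone (tailSum m N) := fun _ _ h =>
  Finset.sum_le_sum_of_subset (Finset.Ico_subset_Ico_left h)

lemma tailSum_self (m : ℕ → ℕ) (N : ℕ) : tailSum m N N = 0 := by simp [tailSum]

lemma tailSum_eq_add {N w : ℕ} (m : ℕ → ℕ) (hw : w < N) :
    tailSum m N w = tailSum m N (w + 1) + m w := by
  rw [tailSum, tailSum, Finset.sum_eq_sum_Ico_succ_bot hw, add_comm]

/-- The `i`-th entry of the nonincreasing sequence with multiplicities `m` on `[1, N)`. -/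
def sortedEntry (m : ℕ → ℕ) (N i : ℕ) : ℕ :=
  ((Finset.range (N - 1)).filter fun t => i < tailSum m N (t + 1)).card

lemma le_sortedEntry_iff (m : ℕ → ℕ) {N i w : ℕ} (hw : 1 ≤ w) (hwN : w ≤ N) :
    w ≤ sortedEntry m N i ↔ i < tailSum m N w := by
  obtain ⟨w, rfl⟩ := Nat.exists_eq_add_of_le' hw
  rcases hwN.eq_or_lt with rfl | h
  · have := Finset.card_filter_le (Finset.range (w + 1 - 1))
      fun t => i < tailSum m (w + 1) (t + 1)
    rw [Finset.card_range] at this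
    simp only [tailSum_self, not_lt_zero, iff_false, sortedEntry]
    omega
  · exact lt_card_filter_range_iff
      (fun i j hij h => h.trans_le (tailSum_anti m N (by omega))) (by omega)

lemma sortedEntry_lt (m : ℕ → ℕ) {N : ℕ} (hN : 1 ≤ N) (i : ℕ) : sortedEntry m N i < N := by
  by_contra h
  have := (le_sortedEntry_iff m hN le_rfl).1 (not_lt.1 h)
  simp [tailSum_self] at this

lemma sortedEntry_eq_iff (m : ℕ → ℕ) {N i v : ℕ} (hv : 1 ≤ v) (hvN : v < N) :
    sortedEntry m N i = v ↔ tailSum m N (v + 1) ≤ i ∧ i < tailSum m N v := by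
  have h1 := le_sortedEntry_iff m (i := i) hv hvN.le
  have h2 := le_sortedEntry_iff m (i := i) (w := v + 1) (by omega) hvN
  omega

lemma sortedEntry_anti (m : ℕ → ℕ) (N : ℕ) {i j : ℕ} (h : i ≤ j) :
    sortedEntry m N j ≤ sortedEntry m N i :=
  Finset.card_le_card fun t ht => by
    rw [Finset.mem_filter] at ht ⊢
    exact ⟨ht.1, by omega⟩

lemma card_sortedEntry_eq (m : ℕ → ℕ) {N n v : ℕ} (hn : tailSum m N 1 = n) (hv : 1 ≤ v)
    (hvN : v < N) :
    (Finset.univ.filter fun i : Fin n => sortedEntry m N i = v).card = m v := by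
  have h1 : tailSum m N v ≤ n := hn ▸ tailSum_anti m N hv
  have h2 := tailSum_eq_add m hvN
  have h3 : (Finset.univ.filter fun i : Fin n => sortedEntry m N i = v) =
      (Finset.univ.filter fun i : Fin n => (i : ℕ) < tailSum m N v) \
        (Finset.univ.filter fun i : Fin n => (i : ℕ) < tailSum m N (v + 1)) := by
    ext i
    simp only [Finset.mem_filter, Finset.mem_univ, true_and, Finset.mem_sdiff,
      sortedEntry_eq_iff m hv hvN]
    omega
  rw [h3, Finset.card_sdiff_of_subset, card_filter_fin_lt h1, card_filter_fin_lt (by omega)]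
  · omega
  · intro i
    simp only [Finset.mem_filter, Finset.mem_univ, true_and]
    omega

lemma Upsilon_sortedEntry (m : ℕ → ℕ) {N n : ℕ} (hN : 1 ≤ N) (hn : tailSum m N 1 = n) :
    ((Upsilon (fun i : Fin n => sortedEntry m N i) : ℚ) : ℂ) =
      ∏ v ∈ Finset.Ico 1 N, ((m v).factorial : ℂ)⁻¹ := by
  have hanti : ∀ i j : Fin n, i ≤ j → sortedEntry m N j ≤ sortedEntry m N i :=
    fun i j hij => sortedEntry_anti m N hij
  rw [Upsilon, if_pos hanti]
  have himage : Finset.univ.image (fun i : Fin n => sortedEntry m N i) ⊆ Finset.Ico 1 N := by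
    intro v hv
    obtain ⟨i, -, rfl⟩ := Finset.mem_image.1 hv
    exact Finset.mem_Ico.2 ⟨(le_sortedEntry_iff m le_rfl hN).2 (hn ▸ i.2), sortedEntry_lt m hN i⟩
  rw [Finset.prod_subset himage]
  · push_cast
    rw [← Finset.prod_inv_distrib]
    refine Finset.prod_congr rfl fun v hv => ?_
    rw [Finset.mem_Ico] at hv
    rw [card_sortedEntry_eq m hn hv.1 hv.2]
  · intro v _ hv
    have : (Finset.univ.filter fun i : Fin n => sortedEntry m N i = v) = ∅ :=
      Finset.filter_eq_empty_iff.2 fun i _ h => hv (Finset.mem_image.2 ⟨i, Finset.mem_univ _, h⟩)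
    simp [this]

lemma tailSum_card {n N : ℕ} (z : Fin n → ℕ) (hN : ∀ i, z i < N) (w : ℕ) :
    tailSum (fun v => (Finset.univ.filter fun i => z i = v).card) N w =
      (Finset.univ.filter fun i => w ≤ z i).card := by
  rw [tailSum, Finset.card_eq_sum_card_fiberwise (f := z) (t := Finset.Ico w N)]
  · refine Finset.sum_congr rfl fun v hv => ?_
    rw [Finset.mem_Ico] at hv
    rw [Finset.filter_filter]
    congr 1
    ext i
    simp only [Finset.mem_filter, Finset.mem_univ, true_and]
    omega
  · intro i hi
    simp only [Finset.coe_filter, Finset.mem_univ, true_and, Set.mem_ofPred_eq] at hi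
    simpa using ⟨hi, hN i⟩

/-- A nonincreasing sequence in `[1, N)` is recovered from its multiplicities. -/
lemma sortedEntry_card {n N : ℕ} (z : Fin n → ℕ) (hz : ∀ i j : Fin n, i ≤ j → z j ≤ z i)
    (h1 : ∀ i, 1 ≤ z i) (hN : ∀ i, z i < N) (i : Fin n) :
    sortedEntry (fun v => (Finset.univ.filter fun i => z i = v).card) N i = z i := by
  have key : ∀ w, 1 ≤ w → w ≤ N →
      (w ≤ sortedEntry (fun v => (Finset.univ.filter fun i => z i = v).card) N i ↔ w ≤ z i) := by
    intro w hw hwN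
    classical
    have hcard : (Finset.univ.filter fun i => w ≤ z i) =
        Finset.univ.filter fun i : Fin n => ∃ h : (i : ℕ) < n, w ≤ z ⟨i, h⟩ := by
      ext i
      simp
    rw [le_sortedEntry_iff _ hw hwN, tailSum_card z hN, hcard,
      card_filter_fin_eq_card_filter_range n (fun t => ∃ h : t < n, w ≤ z ⟨t, h⟩),
      lt_card_filter_range_iff _ i.2]
    · simp
    · rintro t u htu ⟨h, hu⟩
      exact ⟨by omega, hu.trans (hz ⟨t, by omega⟩ ⟨u, h⟩ htu)⟩
  have hzi := h1 i
  have hzN := hN i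
  have ha := (key _ hzi hzN.le).2 le_rfl
  have hb := sortedEntry_lt (fun v => (Finset.univ.filter fun i => z i = v).card)
    (by omega : 1 ≤ N) i
  exact le_antisymm ((key _ (by omega) hb.le).1 le_rfl) ha

end Multiplicities

section Segments

variable {A : Type*} [Ring A]

lemma nestComm_append (c : A) (l l' : List A) :
    nestComm c (l ++ l') = nestComm (nestComm c l) l' := List.foldl_append

lemma nestComm_eq_segComm (a f : ℕ → A) (m : ℕ → ℕ) {N y : ℕ} (hy : y ≤ N) (c : A) {d : ℕ}
    (hd : d ≤ y)
    (hf : ∀ v, y - d ≤ v → v < y → ∀ i, tailSum m N (v + 1) ≤ i → i < tailSum m N v → f i = a v) :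
    nestComm c ((List.range (tailSum m N (y - d) - tailSum m N y)).map
      fun t => f (tailSum m N y + t)) = segComm a m y c d := by
  induction d with
  | zero => simp [nestComm, segComm]
  | succ d ih =>
    have hyd : y - d = (y - (d + 1)) + 1 := by omega
    have h1 : tailSum m N (y - (d + 1)) = tailSum m N (y - d) + m (y - (d + 1)) := by
      rw [hyd]
      exact tailSum_eq_add m (by omega)
    have h2 : tailSum m N y ≤ tailSum m N (y - d) := tailSum_anti m N (by omega)
    have h3 : tailSum m N (y - (d + 1)) - tailSum m N y =
        (tailSum m N (y - d) - tailSum m N y) + m (y - (d + 1)) := by omega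
    rw [h3, List.range_add, List.map_append, nestComm_append,
      ih (by omega) fun v hv => hf v (by omega), segComm]
    congr 1
    rw [List.map_map, List.eq_replicate_iff]
    refine ⟨by simp, fun u hu => ?_⟩
    obtain ⟨t, ht, rfl⟩ := List.mem_map.1 hu
    rw [List.mem_range] at ht
    refine hf _ le_rfl (by omega) _ ?_ ?_
    · rw [← hyd]
      dsimp only
      omega
    · dsimp only
      omega

lemma psum_succ {k : ℕ} (nv : Fin k → ℕ) {j : ℕ} (hj : j < k) :
    psum nv (j + 1) = psum nv j + nv ⟨j, hj⟩ := by
  rw [psum, Finset.sum_range_succ, dif_pos hj, psum]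

lemma psum_mono {k : ℕ} (nv : Fin k → ℕ) : Monotone (psum nv) := fun _ _ h =>
  Finset.sum_le_sum_of_subset (Finset.range_mono h)

lemma psum_eq_sum {k : ℕ} (nv : Fin k → ℕ) : psum nv k = ∑ i, nv i := by
  rw [psum, ← Fin.sum_univ_eq_sum_range (fun t => if h : t < k then nv ⟨t, h⟩ else 0)]
  simp

lemma segIdx_lt_iff {k : ℕ} (nv : Fin k → ℕ) {i j : ℕ} (hj : j ≤ k) :
    segIdx nv i < j ↔ i < psum nv j := by
  rcases j with _ | j
  · simp [psum]
  · have : j < segIdx nv i ↔ psum nv (j + 1) ≤ i :=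
      lt_card_filter_range_iff (fun i j hij h => (psum_mono nv (by omega)).trans h) (by omega)
    omega

/-- The composition recording how many entries fall in each segment `[X (j + 2), X (j + 1))`. -/
def segComposition (X : ℕ → ℕ) (k : ℕ) (m : ℕ → ℕ) (j : Fin k) : ℕ :=
  tailSum m (X 1) (X (j + 2)) - tailSum m (X 1) (X (j + 1))

lemma psum_segComposition {X : ℕ → ℕ} (hX : ∀ q, 1 ≤ q → X (q + 1) ≤ X q) {k : ℕ} (m : ℕ → ℕ)
    {j : ℕ} (hj : j ≤ k) :
    psum (segComposition X k m) j = tailSum m (X 1) (X (j + 1)) := by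
  induction j with
  | zero => simp [psum, tailSum_self]
  | succ j ih =>
    have := tailSum_anti m (X 1) (hX (j + 1) (by omega))
    rw [psum_succ _ hj, ih (by omega), segComposition]
    exact Nat.add_sub_cancel' this

lemma Kfam_eq_multComm (a b f : ℕ → A) {X : ℕ → ℕ} (hX : ∀ q, 1 ≤ q → X (q + 1) ≤ X q) {k : ℕ}
    (m : ℕ → ℕ)
    (hf : ∀ v, X (k + 1) ≤ v → v < X 1 → ∀ i, tailSum m (X 1) (v + 1) ≤ i →
      i < tailSum m (X 1) v → f i = a v) {j : ℕ} (hj : j ≤ k) :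
    Kfam b f (psum (segComposition X k m)) j = multComm a b X m j := by
  have hXanti : AntitoneOn X (Set.Ici 1) := antitoneOn_of_succ_le Set.ordConnected_Ici
    fun q _ hq _ => hX q hq
  induction j with
  | zero => rfl
  | succ j ih =>
    have h1 : X (j + 1) ≤ X 1 := hXanti (by simp) (by simp) (by omega)
    have h2 : X (j + 2) ≤ X (j + 1) := hX (j + 1) (by omega)
    have h3 : X (k + 1) ≤ X (j + 2) := hXanti (by simp) (by simp) (by omega)
    have h4 : X (j + 1) - (X (j + 1) - X (j + 2)) = X (j + 2) := Nat.sub_sub_self h2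
    rw [Kfam, multComm, ih (by omega), psum_segComposition hX m hj,
      psum_segComposition hX m (by omega), ← nestComm_eq_segComm a f m h1 _ (Nat.sub_le _ _), h4]
    rw [h4]
    exact fun v hv hv' => hf v (by omega) (by omega)

end Segments

/-- The sum over compositions and constrained sequences, reindexed by multiplicities. -/
lemma expCoeff_multComm {A : Type*} [NormedRing A] [NormedAlgebra ℂ A] (a b : ℕ → A) {X : ℕ → ℕ}
    (hX : ∀ q, 1 ≤ q → X (q + 1) ≤ X q) (hX1 : ∀ q, 1 ≤ X q) {k : ℕ} (hXk : X (k + 1) = 1)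
    (n : ℕ) :
    expCoeff 1 (X 1) (fun m => multComm a b X m k) n =
      ∑ nv ∈ (Fintype.piFinset fun _ : Fin k => Finset.range (n + 1)).filter
            (fun nv => ∑ i, nv i = n),
        ∑ z ∈ Fintype.piFinset (fun i : Fin n =>
            Finset.Icc (X (segIdx nv (i : ℕ) + 2)) (X (segIdx nv (i : ℕ) + 1) - 1)),
          ((Upsilon z : ℚ) : ℂ) •
            Kfam b (fun t => if h : t < n then a (z ⟨t, h⟩) else 1) (psum nv) k := by
  have hXanti : AntitoneOn X (Set.Ici 1) := antitoneOn_of_succ_le Set.ordConnected_Ici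
    fun q _ hq _ => hX q hq
  have hXle : ∀ p q, p ≤ q → X (q + 1) ≤ X (p + 1) := fun p q h =>
    hXanti (by simp) (by simp) (by omega)
  have htail : ∀ m ∈ Finset.piAntidiag (Finset.Ico 1 (X 1)) n, tailSum m (X 1) 1 = n :=
    fun m hm => (Finset.mem_piAntidiag.1 hm).1
  rw [Finset.sum_sigma', expCoeff]
  refine Finset.sum_of_injOn
    (fun m => ⟨segComposition X k m, fun i : Fin n => sortedEntry m (X 1) i⟩) ?_ ?_ ?_ ?_
  · intro m hm m' hm' h
    have hz := eq_of_heq (Sigma.mk.inj h).2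
    ext v
    by_cases hv : v ∈ Finset.Ico 1 (X 1)
    · rw [Finset.mem_Ico] at hv
      rw [← card_sortedEntry_eq m (htail m hm) hv.1 hv.2,
        ← card_sortedEntry_eq m' (htail m' hm') hv.1 hv.2]
      congr 1
      ext i
      simp [show sortedEntry m (X 1) i = sortedEntry m' (X 1) i from congrFun hz i]
    · rw [not_not.1 fun h => hv ((Finset.mem_piAntidiag.1 hm).2 v h),
        not_not.1 fun h => hv ((Finset.mem_piAntidiag.1 hm').2 v h)]
  · intro m hm
    have hn := htail m hm
    have hsum : ∑ j, segComposition X k m j = n := by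
      rw [← psum_eq_sum, psum_segComposition hX m le_rfl, hXk, hn]
    simp only [Finset.coe_sigma, Set.mem_sigma_iff, Finset.mem_coe, Finset.mem_filter,
      Fintype.mem_piFinset, Finset.mem_range, Finset.mem_Icc]
    refine ⟨⟨fun j => ?_, hsum⟩, fun i => ?_⟩
    · have := Finset.single_le_sum (fun i _ => Nat.zero_le (segComposition X k m i))
        (Finset.mem_univ j)
      omega
    · set s := segIdx (segComposition X k m) i with hs
      have hsk : s < k := by
        rw [hs, segIdx_lt_iff _ le_rfl, psum_eq_sum, hsum]
        exact i.2
      have h1 : (i : ℕ) < tailSum m (X 1) (X (s + 2)) := by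
        rw [← psum_segComposition hX m (Nat.succ_le_of_lt hsk), ← segIdx_lt_iff _ hsk]
        omega
      have h2 : ¬ (i : ℕ) < tailSum m (X 1) (X (s + 1)) := by
        rw [← psum_segComposition hX m hsk.le, ← segIdx_lt_iff _ hsk.le]
        omega
      rw [← le_sortedEntry_iff m (hX1 _) (hXle 0 _ (by omega))] at h1 h2
      exact ⟨h1, Nat.le_sub_one_of_lt (not_le.1 h2)⟩
  · rintro ⟨nv, z⟩ hmem hnot
    simp only [Finset.mem_sigma, Finset.mem_filter, Fintype.mem_piFinset, Finset.mem_range,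
      Finset.mem_Icc] at hmem
    obtain ⟨⟨-, hsum⟩, hz⟩ := hmem
    by_cases hanti : ∀ i j : Fin n, i ≤ j → z j ≤ z i
    swap
    · simp [Upsilon, hanti]
    refine absurd ?_ hnot
    have hz1 : ∀ i, 1 ≤ z i := fun i => (hX1 _).trans (hz i).1
    have hzN : ∀ i, z i < X 1 := fun i => by
      have h1 := (hz i).2
      have h2 := hXle 0 (segIdx nv i) (by omega)
      have h3 := hX1 (segIdx nv i + 1)
      simp only [zero_add] at h2
      omega
    have hpsum : ∀ j ≤ k, psum nv j = tailSum
        (fun v => (Finset.univ.filter fun i => z i = v).card) (X 1) (X (j + 1)) := by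
      intro j hj
      have hle : psum nv j ≤ n := by
        rw [← hsum, ← psum_eq_sum]
        exact psum_mono nv hj
      rw [tailSum_card z hzN, ← card_filter_fin_lt hle]
      congr 1
      ext i
      simp only [Finset.mem_filter, Finset.mem_univ, true_and]
      rw [← segIdx_lt_iff nv hj]
      constructor
      · intro h
        exact (hXle (segIdx nv i + 1) j (by omega)).trans (hz i).1
      · intro h
        by_contra hlt
        have h1 := hXle j (segIdx nv i) (by omega)
        have h2 := (hz i).2
        have h3 := hX1 (segIdx nv i + 1)
        omega
    refine ⟨fun v => (Finset.univ.filter fun i => z i = v).card, ?_, ?_⟩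
    · rw [Finset.mem_coe, Finset.mem_piAntidiag]
      constructor
      · have h := hpsum k le_rfl
        rw [psum_eq_sum, hsum, hXk] at h
        exact h.symm
      · intro v hv
        obtain ⟨i, hi⟩ := Finset.card_ne_zero.1 hv
        obtain rfl := (Finset.mem_filter.1 hi).2
        exact Finset.mem_Ico.2 ⟨hz1 i, hzN i⟩
    · have hfst : segComposition X k (fun v => (Finset.univ.filter fun i => z i = v).card) =
          nv := by
        ext j
        rw [segComposition, ← hpsum (j + 1) j.2, ← hpsum j j.2.le, psum_succ nv j.2]
        simp
      have hsnd : (fun i : Fin n => sortedEntry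
          (fun v => (Finset.univ.filter fun i => z i = v).card) (X 1) i) = z :=
        funext fun i => sortedEntry_card z hanti hz1 hzN i
      simp only [hfst, hsnd]
  · intro m hm
    have hn := htail m hm
    rw [Upsilon_sortedEntry m (hX1 1) hn]
    congr 1
    refine (Kfam_eq_multComm a b _ hX m ?_ le_rfl).symm
    intro v hv hvN i hi hi'
    rw [hXk] at hv
    have hin : i < n := hn ▸ hi'.trans_le (tailSum_anti m (X 1) hv)
    rw [dif_pos hin]
    dsimp only
    rw [(sortedEntry_eq_iff m hv hvN).2 ⟨hi, hi'⟩]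

/-- The product of Heisenberg-picture operators
`(u_{x₁}⁻¹ b₁ u_{x₁}) ⋯ (u_{x_k}⁻¹ b_k u_{x_k})`, with `u_x = exp(a_{x-1}) ⋯ exp(a_1)`,
equals the absolutely convergent series over `n` of the sum over compositions
`(n₁,…,n_k)` of `n` into nonnegative parts and over tuples `z` whose `j`-th segment
entries range over `{x_{j+1},…,x_j − 1}` (and over `{1,…,x_k − 1}` for the last
segment), of `Υ(z) • K(z)`. -/
theorem heisenberg_prod_eq_upsilon_series {A : Type*} [NormedRing A]
    [NormedAlgebra ℂ A] [CompleteSpace A] (k : ℕ) (hk : 1 ≤ k) (x : ℕ → ℕ)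
    (hx : ∀ q : ℕ, 1 ≤ q → q < k → x (q + 1) < x q) (hxk : 1 ≤ x k)
    (a b : ℕ → A) :
    Summable (fun n : ℕ =>
      ‖∑ nv ∈ (Fintype.piFinset fun _ : Fin k => Finset.range (n + 1)).filter
            (fun nv => ∑ i, nv i = n),
          ∑ z ∈ Fintype.piFinset (fun i : Fin n =>
              Finset.Icc (if segIdx nv (i : ℕ) + 2 ≤ k then x (segIdx nv (i : ℕ) + 2) else 1)
                (x (segIdx nv (i : ℕ) + 1) - 1)),
            ((Upsilon z : ℚ) : ℂ) •
              Kfam b (fun t => if h : t < n then a (z ⟨t, h⟩) else 1) (psum nv) k‖) ∧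
    HasSum (fun n : ℕ =>
      ∑ nv ∈ (Fintype.piFinset fun _ : Fin k => Finset.range (n + 1)).filter
            (fun nv => ∑ i, nv i = n),
        ∑ z ∈ Fintype.piFinset (fun i : Fin n =>
            Finset.Icc (if segIdx nv (i : ℕ) + 2 ≤ k then x (segIdx nv (i : ℕ) + 2) else 1)
              (x (segIdx nv (i : ℕ) + 1) - 1)),
          ((Upsilon z : ℚ) : ℂ) •
            Kfam b (fun t => if h : t < n then a (z ⟨t, h⟩) else 1) (psum nv) k)
      (List.ofFn fun i : Fin k =>
          Ubwd a (x ((i : ℕ) + 1)) 1 * b ((i : ℕ) + 1) * Ufwd a (x ((i : ℕ) + 1)) 1).prod := by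
  set X : ℕ → ℕ := fun q => if 1 ≤ q ∧ q ≤ k then x q else 1 with hXdef
  have hXx : ∀ q, 1 ≤ q → q ≤ k → X q = x q := fun q h1 h2 => if_pos ⟨h1, h2⟩
  have hX1' : ∀ q, k < q → X q = 1 := fun q h => if_neg (by omega)
  have hpos : ∀ q ≤ k, 1 ≤ q → 1 ≤ x q := fun q hqk => by
    induction hqk using Nat.decreasingInduction with
    | self => exact fun _ => hxk
    | of_succ q hq ih => exact fun h => (ih (by omega)).trans (hx q h hq).le
  have hX1 : ∀ q, 1 ≤ X q := fun q => by
    by_cases h : 1 ≤ q ∧ q ≤ k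
    · rw [hXx q h.1 h.2]
      exact hpos q h.2 h.1
    · exact (if_neg h).ge
  have hX : ∀ q, 1 ≤ q → X (q + 1) ≤ X q := fun q hq => by
    by_cases h : q < k
    · rw [hXx q hq h.le, hXx (q + 1) (by omega) h]
      exact (hx q hq h).le
    · rw [hX1' (q + 1) (by omega)]
      exact hX1 q
  have key := isExpansion_multComm a b hX hX1 hk (hX1' (k + 1) (by omega))
  have hprod : (fun i : Fin k =>
      Ubwd a (X ((i : ℕ) + 1)) 1 * b ((i : ℕ) + 1) * Ufwd a (X ((i : ℕ) + 1)) 1) = fun i : Fin k =>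
      Ubwd a (x ((i : ℕ) + 1)) 1 * b ((i : ℕ) + 1) * Ufwd a (x ((i : ℕ) + 1)) 1 :=
    funext fun i => by rw [hXx _ (by omega) i.2]
  have hcoeff : ∀ n, expCoeff 1 (X 1) (fun m => multComm a b X m k) n = _ :=
    fun n => (expCoeff_multComm a b hX hX1 (hX1' (k + 1) (by omega)) n).trans
      (Finset.sum_congr rfl fun nv hnv => Finset.sum_congr
        (congrArg Fintype.piFinset (funext fun i : Fin n => by
          have hs : segIdx nv i < k := by
            rw [segIdx_lt_iff nv le_rfl, psum_eq_sum, (Finset.mem_filter.1 hnv).2]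
            exact i.2
          have hlo : X (segIdx nv i + 2) =
              if segIdx nv (i : ℕ) + 2 ≤ k then x (segIdx nv (i : ℕ) + 2) else 1 :=
            if_congr (by omega) rfl rfl
          rw [hlo, hXx (segIdx nv i + 1) (by omega) hs])) fun z _ => rfl)
  rw [hprod] at key
  exact ⟨key.summable_norm.congr fun n => congrArg norm (hcoeff n),
    key.hasSum.congr_fun fun n => (hcoeff n).symm⟩
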